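/- Let W ∈ ℝ^{m×n}, let A, B ∈ ℝ^{n×l} with BBᵀ invertible, let k ∈ ℕ, and let L_B ∈ ℝ^{n×n} be an invertible matrix with BBᵀ = L_B L_Bᵀ. Then the map W' ↦ W' L_B is a rank-preserving bijection of ℝ^{m×n}, and minimizing ‖W A − W' B‖_F² over {W' : rank(W') ≤ k} is equivalent to minimizing ‖Z − M‖_F² over {Z : rank(Z) ≤ k} with M := W A Bᵀ L_B^{-ᵀ}: the two problems have the same set of optimal values, and W' is optimal for the first if and only if Z = W' L_B is optimal for the second. -/

import Mathlib

open Matrix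

noncomputable section

/-- The squared Frobenius norm of a real matrix. -/
def frobSq {m n : ℕ} (M : Matrix (Fin m) (Fin n) ℝ) : ℝ := ∑ i, ∑ j, (M i j) ^ 2

theorem frobSq_eq_trace {m n : ℕ} (M : Matrix (Fin m) (Fin n) ℝ) :
    frobSq M = (M * Mᵀ).trace := by
  simp [frobSq, Matrix.trace, Matrix.mul_apply, sq]

theorem frobSq_sub {m n : ℕ} (P Q : Matrix (Fin m) (Fin n) ℝ) :
    frobSq (P - Q) = frobSq P + frobSq Q - 2 * (P * Qᵀ).trace := by
  have h : (Q * Pᵀ).trace = (P * Qᵀ).trace := by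
    rw [← Matrix.trace_transpose, Matrix.transpose_mul, Matrix.transpose_transpose]
  simp only [frobSq_eq_trace, Matrix.transpose_sub, Matrix.sub_mul, Matrix.mul_sub,
    Matrix.trace_sub, h]
  ring

/-- Completing the square: the two least-squares objectives differ by a constant. -/
theorem frobSq_sub_mul_eq {m n l : ℕ} (C : Matrix (Fin m) (Fin l) ℝ)
    (B : Matrix (Fin n) (Fin l) ℝ) (L : Matrix (Fin n) (Fin n) ℝ) (hL : IsUnit L.det)
    (hfac : B * Bᵀ = L * Lᵀ) (X : Matrix (Fin m) (Fin n) ℝ) :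
    frobSq (C - X * B) = frobSq (X * L - C * Bᵀ * (L⁻¹)ᵀ) +
      (frobSq C - frobSq (C * Bᵀ * (L⁻¹)ᵀ)) := by
  have hquad : frobSq (X * B) = frobSq (X * L) := by
    rw [frobSq_eq_trace, frobSq_eq_trace, Matrix.transpose_mul, Matrix.transpose_mul,
      Matrix.mul_assoc, ← Matrix.mul_assoc B, hfac]
    simp only [Matrix.mul_assoc]
  have hcross : (X * L * (C * Bᵀ * (L⁻¹)ᵀ)ᵀ).trace = (C * (X * B)ᵀ).trace := by
    rw [← Matrix.trace_transpose (C * (X * B)ᵀ)]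
    simp only [Matrix.transpose_mul, Matrix.transpose_transpose, Matrix.mul_assoc]
    rw [Matrix.mul_nonsing_inv_cancel_left L _ hL]
  rw [frobSq_sub, frobSq_sub, hquad, hcross]
  ring

/-- With `B Bᵀ` invertible and `B Bᵀ = L Lᵀ` for invertible `L`, the map `W' ↦ W' L` is a
rank-preserving bijection, and minimizing `‖W A − W' B‖_F²` over `{rank ≤ k}` is
equivalent to minimizing `‖Z − M‖_F²` over `{rank ≤ k}` with `M := W A Bᵀ L⁻ᵀ`:
`W'` is optimal for the first problem iff `Z = W' L` is optimal for the second, and the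
bijection maps the set of optimizers of the first problem onto that of the second. -/
theorem change_of_variables_lowrank {m n l k : ℕ}
    (W : Matrix (Fin m) (Fin n) ℝ) (A B : Matrix (Fin n) (Fin l) ℝ)
    (hBB : IsUnit (B * Bᵀ).det)
    (L : Matrix (Fin n) (Fin n) ℝ) (hL : IsUnit L.det) (hfac : B * Bᵀ = L * Lᵀ) :
    Function.Bijective (fun W' : Matrix (Fin m) (Fin n) ℝ => W' * L) ∧
    (∀ W' : Matrix (Fin m) (Fin n) ℝ, (W' * L).rank = W'.rank) ∧
    (∀ W' : Matrix (Fin m) (Fin n) ℝ, W'.rank ≤ k →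
      ((∀ Z : Matrix (Fin m) (Fin n) ℝ, Z.rank ≤ k →
          frobSq (W * A - W' * B) ≤ frobSq (W * A - Z * B)) ↔
        (∀ Z : Matrix (Fin m) (Fin n) ℝ, Z.rank ≤ k →
          frobSq (W' * L - W * A * Bᵀ * (L⁻¹)ᵀ) ≤ frobSq (Z - W * A * Bᵀ * (L⁻¹)ᵀ)))) ∧
    ((fun W' : Matrix (Fin m) (Fin n) ℝ => W' * L) ''
        {W' : Matrix (Fin m) (Fin n) ℝ | W'.rank ≤ k ∧
          ∀ Z : Matrix (Fin m) (Fin n) ℝ, Z.rank ≤ k →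
            frobSq (W * A - W' * B) ≤ frobSq (W * A - Z * B)} =
      {Z : Matrix (Fin m) (Fin n) ℝ | Z.rank ≤ k ∧
          ∀ Y : Matrix (Fin m) (Fin n) ℝ, Y.rank ≤ k →
            frobSq (Z - W * A * Bᵀ * (L⁻¹)ᵀ) ≤ frobSq (Y - W * A * Bᵀ * (L⁻¹)ᵀ)}) := by
  have hrank (X : Matrix (Fin m) (Fin n) ℝ) : (X * L).rank = X.rank :=
    Matrix.rank_mul_eq_left_of_isUnit_det L X hL
  have hcancel (Z : Matrix (Fin m) (Fin n) ℝ) : Z * L⁻¹ * L = Z :=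
    Matrix.nonsing_inv_mul_cancel_right L Z hL
  have hrank_inv (Z : Matrix (Fin m) (Fin n) ℝ) : (Z * L⁻¹).rank = Z.rank := by
    rw [← hrank, hcancel]
  have hobj := frobSq_sub_mul_eq (W * A) B L hL hfac
  have hopt (X : Matrix (Fin m) (Fin n) ℝ) :
      (∀ Z : Matrix (Fin m) (Fin n) ℝ, Z.rank ≤ k →
          frobSq (W * A - X * B) ≤ frobSq (W * A - Z * B)) ↔
        (∀ Z : Matrix (Fin m) (Fin n) ℝ, Z.rank ≤ k →
          frobSq (X * L - W * A * Bᵀ * (L⁻¹)ᵀ) ≤ frobSq (Z - W * A * Bᵀ * (L⁻¹)ᵀ)) := by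
    simp only [hobj, add_le_add_iff_right]
    refine ⟨fun h Z hZ => ?_, fun h Z hZ => h _ ((hrank Z).trans_le hZ)⟩
    simpa only [hcancel] using h (Z * L⁻¹) ((hrank_inv Z).trans_le hZ)
  refine ⟨⟨fun X Y h => ?_, fun Z => ⟨Z * L⁻¹, hcancel Z⟩⟩, hrank, fun X _ => hopt X, ?_⟩
  · simpa only [Matrix.mul_nonsing_inv_cancel_right L _ hL] using congrArg (· * L⁻¹) h
  · ext Z
    constructor
    · rintro ⟨X, ⟨hX, hmin⟩, rfl⟩
      exact ⟨(hrank X).trans_le hX, (hopt X).1 hmin⟩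
    · rintro ⟨hZ, hmin⟩
      refine ⟨Z * L⁻¹, ⟨(hrank_inv Z).trans_le hZ, (hopt _).2 ?_⟩, hcancel Z⟩
      rwa [hcancel]
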